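/- arXiv:1811.04006 — 2 statements merged into one kernel-verified Lean document; each statement's English description precedes it below -/
import Mathlib

section
/- Suppose that for each k = 0, …, N−1 there is a Borel-measurable function μ̂_k : ℝ^d → U attaining the supremum in the dynamic-programming recursion, i.e. ∫_S J_{k+1}(z) p(x, μ̂_k(x), z) dz = J_k(x) for every x ∈ ℝ^d. Then the policy π̂ = (μ̂_0, …, μ̂_{N−1}) satisfies V'(k, x) = J_k(x) for every k = 0, …, N and every x ∈ ℝ^d (where V' is computed from π̂); consequently π̂ is optimal: for every policy π, every k, and every x ∈ ℝ^d, the cost of π at (k,x) is at most the cost of π̂ at (k,x). -/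
open MeasureTheory

/-- Backward induction from `N` down to `0`. -/
theorem backward_induction {N : ℕ} {P : ℕ → Prop} (base : P N)
    (step : ∀ k : Fin N, P ((k : ℕ) + 1) → P k) : ∀ k ≤ N, P k := fun _ hk =>
  Nat.decreasingInduction (motive := fun k _ => P k) (fun k hk ih => step ⟨k, hk⟩ ih) base hk

/-- The product of a measurable `[0, 1]`-valued function with an integrable function is
integrable. -/
theorem integrable_mul_of_mem_Icc {α : Type*} [MeasurableSpace α] {ν : Measure α} {f g : α → ℝ}
    (hf : Measurable f) (hf01 : ∀ z, f z ∈ Set.Icc (0 : ℝ) 1) (hg : Integrable g ν) :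
    Integrable (fun z => f z * g z) ν :=
  hg.bdd_mul (c := 1) hf.aestronglyMeasurable <| ae_of_all _ fun z => by
    rw [Real.norm_eq_abs, abs_of_nonneg (hf01 z).1]
    exact (hf01 z).2

/-- The integral over `S` of a measurable `[0, 1]`-valued function against a probability density
lies in `[0, 1]`. -/
theorem setIntegral_mul_density_mem_Icc {α : Type*} [MeasurableSpace α] {ν : Measure α}
    {S : Set α} {f g : α → ℝ} (hf01 : ∀ z, f z ∈ Set.Icc (0 : ℝ) 1)
    (hg0 : ∀ z, 0 ≤ g z) (hg1 : ∫ z, g z ∂ν = 1) :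
    ∫ z in S, f z * g z ∂ν ∈ Set.Icc (0 : ℝ) 1 := by
  have hg : Integrable g ν := .of_integral_ne_zero (by simp [hg1])
  refine ⟨integral_nonneg fun z => mul_nonneg (hf01 z).1 (hg0 z), ?_⟩
  calc ∫ z in S, f z * g z ∂ν ≤ ∫ z in S, g z ∂ν :=
        integral_mono_of_nonneg (ae_of_all _ fun z => mul_nonneg (hf01 z).1 (hg0 z))
          hg.integrableOn (ae_of_all _ fun z => mul_le_of_le_one_left (hg0 z) (hf01 z).2)
    _ ≤ ∫ z, g z ∂ν := setIntegral_le_integral hg (ae_of_all _ hg0)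
    _ = 1 := hg1

/-- If for each `k < N` there is a Borel-measurable feedback `μ̂_k` with
values in `U` attaining the supremum in the dynamic-programming recursion, i.e.
`∫_S J_{k+1}(z) p(x, μ̂_k(x), z) dz = J_k(x)` for every `x`, then the policy
`π̂ = (μ̂_0, …, μ̂_{N-1})` satisfies `V'(k,x) = J_k(x)` for every `k = 0, …, N` and every `x`
(where `V'` is computed from `π̂`); consequently `π̂` is optimal: for every policy `π`,
every `k`, and every `x`, the cost of `π` at `(k,x)` is at most the cost of `π̂` at `(k,x)`. -/
theorem stmt_4
    (d m N : ℕ) (hd : 1 ≤ d)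
    (U : Set (Fin m → ℝ)) (hU : U.Nonempty)
    (S : Set (Fin d → ℝ)) (hS : MeasurableSet S)
    (XT : Set (Fin d → ℝ)) (hXT : MeasurableSet XT)
    (p : (Fin d → ℝ) → (Fin m → ℝ) → (Fin d → ℝ) → ℝ)
    (hp_meas : Measurable (fun q : ((Fin d → ℝ) × (Fin m → ℝ)) × (Fin d → ℝ) =>
      p q.1.1 q.1.2 q.2))
    (hp_nonneg : ∀ x u z, 0 ≤ p x u z)
    (hp_int : ∀ x u, ∫ z, p x u z = 1)
    (J : ℕ → (Fin d → ℝ) → ℝ)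
    (hJ_meas : ∀ k ≤ N, Measurable (J k))
    (hJN : ∀ x, J N x = XT.indicator (fun _ => (1 : ℝ)) x)
    (hJrec : ∀ k : Fin N, ∀ x,
      J k x = sSup ((fun u => ∫ z in S, J ((k : ℕ) + 1) z * p x u z) '' U))
    -- the optimal feedbacks μ̂ attaining the supremum
    (μhat : Fin N → (Fin d → ℝ) → (Fin m → ℝ))
    (hμhat_meas : ∀ k, Measurable (μhat k))
    (hμhat_mem : ∀ k x, μhat k x ∈ U)
    (hμhat_opt : ∀ k : Fin N, ∀ x,
      (∫ z in S, J ((k : ℕ) + 1) z * p x (μhat k x) z) = J k x)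
    -- the reach-while-stay cost of the policy π̂ = (μ̂_0, …, μ̂_{N-1})
    (Vhat : ℕ → (Fin d → ℝ) → ℝ)
    (hVhatN : ∀ x, Vhat N x = XT.indicator (fun _ => (1 : ℝ)) x)
    (hVhatrec : ∀ k : Fin N, ∀ x,
      Vhat k x = ∫ z in S, Vhat ((k : ℕ) + 1) z * p x (μhat k x) z) :
    (∀ k ≤ N, ∀ x, Vhat k x = J k x) ∧
      (∀ (μ : Fin N → (Fin d → ℝ) → (Fin m → ℝ)) (V' : ℕ → (Fin d → ℝ) → ℝ),
        (∀ k, Measurable (μ k)) → (∀ k x, μ k x ∈ U) →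
        (∀ x, V' N x = XT.indicator (fun _ => (1 : ℝ)) x) →
        (∀ k : Fin N, ∀ x, V' k x = ∫ z in S, V' ((k : ℕ) + 1) z * p x (μ k x) z) →
        ∀ k ≤ N, ∀ x, V' k x ≤ Vhat k x) := by
  have hVJ : ∀ k ≤ N, ∀ x, Vhat k x = J k x := by
    refine backward_induction (fun x => (hVhatN x).trans (hJN x).symm) fun k ih x => ?_
    simp_rw [hVhatrec k x, ih, hμhat_opt k x]
  have hind : ∀ x, XT.indicator (fun _ => (1 : ℝ)) x ∈ Set.Icc (0 : ℝ) 1 := fun x =>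
    ⟨Set.indicator_nonneg (fun _ _ => zero_le_one) x,
      Set.indicator_le_self' (fun _ _ => zero_le_one) x⟩
  have hJ01 : ∀ k ≤ N, ∀ x, J k x ∈ Set.Icc (0 : ℝ) 1 := by
    refine backward_induction (fun x => hJN x ▸ hind x) fun k ih x => ?_
    rw [← hμhat_opt k x]
    exact setIntegral_mul_density_mem_Icc ih (hp_nonneg _ _) (hp_int _ _)
  refine ⟨hVJ, fun μ V' _ hμU hV'N hV'rec => ?_⟩
  have hV'0 : ∀ k ≤ N, ∀ x, 0 ≤ V' k x := by
    refine backward_induction (fun x => hV'N x ▸ (hind x).1) fun k ih x => ?_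
    rw [hV'rec k x]
    exact integral_nonneg fun z => mul_nonneg (ih z) (hp_nonneg _ _ _)
  have hV'J : ∀ k ≤ N, ∀ x, V' k x ≤ J k x := by
    refine backward_induction (fun x => (hV'N x).trans_le (hJN x).ge) fun k ih x => ?_
    have hp : Integrable (p x (μ k x)) := .of_integral_ne_zero (by simp [hp_int])
    calc V' k x = ∫ z in S, V' ((k : ℕ) + 1) z * p x (μ k x) z := hV'rec k x
      _ ≤ ∫ z in S, J ((k : ℕ) + 1) z * p x (μ k x) z :=
        integral_mono_of_nonneg
          (ae_of_all _ fun z => mul_nonneg (hV'0 _ k.2 z) (hp_nonneg _ _ _))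
          (integrable_mul_of_mem_Icc (hJ_meas _ k.2) (hJ01 _ k.2) hp.integrableOn)
          (ae_of_all _ fun z => mul_le_mul_of_nonneg_right (ih z) (hp_nonneg _ _ _))
      _ ≤ J k x := by
        rw [hJrec k x]
        refine le_csSup ⟨1, ?_⟩ ⟨μ k x, hμU k x, rfl⟩
        rintro _ ⟨u, -, rfl⟩
        exact (setIntegral_mul_density_mem_Icc (hJ01 _ k.2) (hp_nonneg x u) (hp_int x u)).2
  exact fun k hk x => (hV'J k hk x).trans_eq (hVJ k hk x).symm
end

section
/- Suppose that for each k = 0, …, N−1 there is a Borel-measurable function μ̂_k : ℝ^d → U attaining the supremum in the dynamic-programming recursion, i.e. ∫_S J_{k+1}(z) p(x, μ̂_k(x), z) dz = J_k(x) for every x ∈ ℝ^d. Then for every nonnegative integrable weight function w : ℝ^d → ℝ, the optimal value of the reach-while-stay problem satisfies sup_{π} ∫_S V'_π(0, x) w(x) dx = ∫_S J_0(x) w(x) dx, where the supremum is over all policies π and V'_π denotes the reach-while-stay cost computed from π; the supremum is attained by π̂ = (μ̂_0, …, μ̂_{N−1}). -/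
open MeasureTheory

section ReachWhileStay

variable {X A : Type*} [MeasurableSpace X] [MeasurableSpace A]

/-- A measurable `[0, 1]`-valued function times an integrable function is integrable on any set. -/
lemma integrableOn_mul_of_mem_Icc {ν : Measure X} {S : Set X} {f q : X → ℝ} (hf : Measurable f)
    (hf01 : ∀ z, f z ∈ Set.Icc (0 : ℝ) 1) (hq : Integrable q ν) :
    IntegrableOn (fun z => f z * q z) S ν :=
  (hq.bdd_mul (c := 1) hf.aestronglyMeasurable (Filter.Eventually.of_forall fun z => by
    rw [Real.norm_of_nonneg (hf01 z).1]; exact (hf01 z).2)).integrableOn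

/-- Integrating a measurable `[0, 1]`-valued function over a set against a probability density
gives a value in `[0, 1]`. -/
lemma setIntegral_mul_density_mem_Icc_s5 {ν : Measure X} {S : Set X} {f q : X → ℝ}
    (hf : Measurable f) (hf01 : ∀ z, f z ∈ Set.Icc (0 : ℝ) 1)
    (hq0 : ∀ z, 0 ≤ q z) (hq1 : ∫ z, q z ∂ν = 1) :
    ∫ z in S, f z * q z ∂ν ∈ Set.Icc (0 : ℝ) 1 := by
  have hq : Integrable q ν := integrable_of_integral_eq_one hq1
  refine ⟨integral_nonneg fun z => mul_nonneg (hf01 z).1 (hq0 z), ?_⟩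
  calc ∫ z in S, f z * q z ∂ν ≤ ∫ z in S, q z ∂ν :=
        integral_mono (integrableOn_mul_of_mem_Icc hf hf01 hq) hq.integrableOn
          fun z => mul_le_of_le_one_left (hq0 z) (hf01 z).2
    _ ≤ ∫ z, q z ∂ν := setIntegral_le_integral hq (Filter.Eventually.of_forall hq0)
    _ = 1 := hq1

/-- The reach-while-stay cost of a measurable policy is measurable with values in `[0, 1]`. -/
lemma measurable_and_mem_Icc_of_recursion {ν : Measure X} [SFinite ν] {N : ℕ} {S XT : Set X}
    (hXT : MeasurableSet XT) {p : X → A → X → ℝ}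
    (hp_meas : Measurable (fun q : (X × A) × X => p q.1.1 q.1.2 q.2))
    (hp_nonneg : ∀ x u z, 0 ≤ p x u z) (hp_int : ∀ x u, ∫ z, p x u z ∂ν = 1)
    {μ : Fin N → X → A} (hμ : ∀ k, Measurable (μ k)) {V : ℕ → X → ℝ}
    (hVN : ∀ x, V N x = XT.indicator (fun _ => (1 : ℝ)) x)
    (hVrec : ∀ k : Fin N, ∀ x,
      V k x = ∫ z in S, V ((k : ℕ) + 1) z * p x (μ k x) z ∂ν) {k : ℕ} (hk : k ≤ N) :
    Measurable (V k) ∧ ∀ x, V k x ∈ Set.Icc (0 : ℝ) 1 := by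
  induction hk using Nat.decreasingInduction with
  | self =>
    rw [funext hVN]
    refine ⟨measurable_const.indicator hXT, fun x => ?_⟩
    by_cases hx : x ∈ XT <;> simp [hx]
  | of_succ k hk ih =>
    have hrec := hVrec ⟨k, hk⟩
    simp only at hrec
    refine ⟨?_, fun x => ?_⟩
    · rw [funext hrec]
      have hmeas : Measurable (fun q : X × X => V (k + 1) q.2 * p q.1 (μ ⟨k, hk⟩ q.1) q.2) :=
        (ih.1.comp measurable_snd).mul (hp_meas.comp
          ((measurable_fst.prodMk ((hμ _).comp measurable_fst)).prodMk measurable_snd))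
      exact hmeas.stronglyMeasurable.integral_prod_right'.measurable
    · rw [hrec]
      exact setIntegral_mul_density_mem_Icc_s5 ih.1 ih.2 (hp_nonneg x _) (hp_int x _)

end ReachWhileStay

/-- If for each `k < N` there is a Borel-measurable feedback `μ̂_k` with
values in `U` attaining the supremum in the dynamic-programming recursion, then for every
nonnegative integrable weight `w`, the optimal value of the reach-while-stay problem
satisfies `sup_π ∫_S V'_π(0,x) w(x) dx = ∫_S J_0(x) w(x) dx`, the supremum being over all
policies `π`; moreover the supremum is attained by `π̂ = (μ̂_0, …, μ̂_{N-1})`. -/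
theorem stmt_5
    (d m N : ℕ) (hd : 1 ≤ d)
    (U : Set (Fin m → ℝ)) (hU : U.Nonempty)
    (S : Set (Fin d → ℝ)) (hS : MeasurableSet S)
    (XT : Set (Fin d → ℝ)) (hXT : MeasurableSet XT)
    (p : (Fin d → ℝ) → (Fin m → ℝ) → (Fin d → ℝ) → ℝ)
    (hp_meas : Measurable (fun q : ((Fin d → ℝ) × (Fin m → ℝ)) × (Fin d → ℝ) =>
      p q.1.1 q.1.2 q.2))
    (hp_nonneg : ∀ x u z, 0 ≤ p x u z)
    (hp_int : ∀ x u, ∫ z, p x u z = 1)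
    (J : ℕ → (Fin d → ℝ) → ℝ)
    (hJ_meas : ∀ k ≤ N, Measurable (J k))
    (hJN : ∀ x, J N x = XT.indicator (fun _ => (1 : ℝ)) x)
    (hJrec : ∀ k : Fin N, ∀ x,
      J k x = sSup ((fun u => ∫ z in S, J ((k : ℕ) + 1) z * p x u z) '' U))
    -- the optimal feedbacks μ̂ attaining the supremum
    (μhat : Fin N → (Fin d → ℝ) → (Fin m → ℝ))
    (hμhat_meas : ∀ k, Measurable (μhat k))
    (hμhat_mem : ∀ k x, μhat k x ∈ U)
    (hμhat_opt : ∀ k : Fin N, ∀ x,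
      (∫ z in S, J ((k : ℕ) + 1) z * p x (μhat k x) z) = J k x)
    -- the reach-while-stay cost of the policy π̂ = (μ̂_0, …, μ̂_{N-1})
    (Vhat : ℕ → (Fin d → ℝ) → ℝ)
    (hVhatN : ∀ x, Vhat N x = XT.indicator (fun _ => (1 : ℝ)) x)
    (hVhatrec : ∀ k : Fin N, ∀ x,
      Vhat k x = ∫ z in S, Vhat ((k : ℕ) + 1) z * p x (μhat k x) z)
    -- a nonnegative integrable weight function
    (w : (Fin d → ℝ) → ℝ)
    (hw_meas : Measurable w) (hw_nonneg : ∀ x, 0 ≤ w x) (hw_int : Integrable w) :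
    sSup {r : ℝ | ∃ (μ : Fin N → (Fin d → ℝ) → (Fin m → ℝ)) (V' : ℕ → (Fin d → ℝ) → ℝ),
        (∀ k, Measurable (μ k)) ∧ (∀ k x, μ k x ∈ U) ∧
        (∀ x, V' N x = XT.indicator (fun _ => (1 : ℝ)) x) ∧
        (∀ k : Fin N, ∀ x, V' k x = ∫ z in S, V' ((k : ℕ) + 1) z * p x (μ k x) z) ∧
        r = ∫ x in S, V' 0 x * w x}
      = (∫ x in S, J 0 x * w x) ∧
    (∫ x in S, Vhat 0 x * w x) = ∫ x in S, J 0 x * w x := by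
  have hJ : ∀ k ≤ N, Measurable (J k) ∧ ∀ x, J k x ∈ Set.Icc (0 : ℝ) 1 := fun k hk =>
    measurable_and_mem_Icc_of_recursion hXT hp_meas hp_nonneg hp_int hμhat_meas hJN
      (fun k x => (hμhat_opt k x).symm) hk
  have hVhat_eq : ∀ k ≤ N, Vhat k = J k := by
    intro k hk
    induction hk using Nat.decreasingInduction with
    | self => funext x; rw [hVhatN, hJN]
    | of_succ k hk ih =>
      funext x
      have h := hVhatrec ⟨k, hk⟩ x
      simp only [ih] at h
      exact h.trans (hμhat_opt ⟨k, hk⟩ x)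
  have hVhat0 : (∫ x in S, Vhat 0 x * w x) = ∫ x in S, J 0 x * w x := by
    rw [hVhat_eq 0 N.zero_le]
  refine ⟨IsGreatest.csSup_eq ⟨⟨μhat, Vhat, hμhat_meas, hμhat_mem, hVhatN, hVhatrec,
    hVhat0.symm⟩, ?_⟩, hVhat0⟩
  rintro r ⟨μ, V, hμ, hμU, hVN, hVrec, rfl⟩
  have hV : ∀ k ≤ N, Measurable (V k) ∧ ∀ x, V k x ∈ Set.Icc (0 : ℝ) 1 := fun k hk =>
    measurable_and_mem_Icc_of_recursion hXT hp_meas hp_nonneg hp_int hμ hVN hVrec hk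
  have hle : ∀ k ≤ N, ∀ x, V k x ≤ J k x := by
    intro k hk
    induction hk using Nat.decreasingInduction with
    | self => intro x; rw [hVN, hJN]
    | of_succ k hk ih =>
      intro x
      have hpi : ∀ u, Integrable (p x u) := fun u => integrable_of_integral_eq_one (hp_int x u)
      obtain ⟨hJm, hJ01⟩ := hJ (k + 1) hk
      obtain ⟨hVm, hV01⟩ := hV (k + 1) hk
      calc V k x = ∫ z in S, V (k + 1) z * p x (μ ⟨k, hk⟩ x) z := hVrec ⟨k, hk⟩ x
        _ ≤ ∫ z in S, J (k + 1) z * p x (μ ⟨k, hk⟩ x) z :=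
          integral_mono (integrableOn_mul_of_mem_Icc hVm hV01 (hpi _))
            (integrableOn_mul_of_mem_Icc hJm hJ01 (hpi _))
            fun z => mul_le_mul_of_nonneg_right (ih z) (hp_nonneg x _ z)
        _ ≤ sSup ((fun u => ∫ z in S, J (k + 1) z * p x u z) '' U) := by
          refine le_csSup ⟨1, ?_⟩ ⟨_, hμU ⟨k, hk⟩ x, rfl⟩
          rintro _ ⟨u, -, rfl⟩
          exact (setIntegral_mul_density_mem_Icc_s5 hJm hJ01 (hp_nonneg x u) (hp_int x u)).2
        _ = J k x := (hJrec ⟨k, hk⟩ x).symm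
  obtain ⟨hJm, hJ01⟩ := hJ 0 N.zero_le
  obtain ⟨hVm, hV01⟩ := hV 0 N.zero_le
  exact integral_mono (integrableOn_mul_of_mem_Icc hVm hV01 hw_int)
    (integrableOn_mul_of_mem_Icc hJm hJ01 hw_int)
    fun x => mul_le_mul_of_nonneg_right (hle 0 N.zero_le x) (hw_nonneg x)
end
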